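/- arXiv:1912.08363 — 6 statements merged into one kernel-verified Lean document; each statement's English description precedes it below -/
import Mathlib

section
/- Let η be a probability measure on ℝ concentrated on [0,∞) and suppose that for some n₀ ∈ ℕ the n₀-fold convolution power η^{n₀*} belongs to the class OS. Then: (i) for every a ≥ 0 there exists a constant C(a) > 0 such that tail(η^{n₀*})(x−a) ≤ C(a)·tail(η^{n₀*})(x) for all x > 0; (ii) there exists a constant K > 1 such that for all n ∈ ℕ and all x > 0, tail(η^{n*})(x) ≤ K^n · tail(η^{n₀*})(x). -/
open MeasureTheory Filter Set

/-- The tail `ξ((x,∞))` of a measure on `ℝ`, as a real number. -/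
noncomputable def tail (ξ : MeasureTheory.Measure ℝ) (x : ℝ) : ℝ :=
  (ξ (Set.Ioi x)).toReal

/-- The `n`-fold convolution power of a measure, with `ξ^{0*} = δ₀`. -/
noncomputable def convPow (ρ : MeasureTheory.Measure ℝ) : ℕ → MeasureTheory.Measure ℝ
  | 0 => MeasureTheory.Measure.dirac 0
  | n + 1 => (convPow ρ n).conv ρ

/-- `ξ ≍ ζ` for tails: `0 < liminf tail ξ/tail ζ ≤ limsup tail ξ/tail ζ < ∞`
(taken in `ℝ≥0∞`). -/
def TailAsymp (ξ ζ : MeasureTheory.Measure ℝ) : Prop :=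
  0 < Filter.atTop.liminf (fun x : ℝ => ξ (Set.Ioi x) / ζ (Set.Ioi x)) ∧
    Filter.atTop.limsup (fun x : ℝ => ξ (Set.Ioi x) / ζ (Set.Ioi x)) < ⊤

/-- The class `OS` of O-subexponential distributions. -/
def MemOS (ρ : MeasureTheory.Measure ℝ) : Prop :=
  (∀ x : ℝ, 0 < x → 0 < ρ (Set.Ioi x)) ∧ TailAsymp (convPow ρ 2) ρ

/-- The class `L(γ)`: `tail ρ(x+a) ~ e^{-γ a} tail ρ(x)` for every `a`. -/
def MemL (γ : ℝ) (ρ : MeasureTheory.Measure ℝ) : Prop :=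
  (∀ x : ℝ, 0 < x → 0 < ρ (Set.Ioi x)) ∧
    ∀ a : ℝ, Filter.Tendsto
      (fun x : ℝ => tail ρ (x + a) / (Real.exp (-γ * a) * tail ρ x))
      Filter.atTop (nhds 1)

/-- The class `S(γ)`. -/
def MemS (γ : ℝ) (ρ : MeasureTheory.Measure ℝ) : Prop :=
  MemL γ ρ ∧ MeasureTheory.Integrable (fun x : ℝ => Real.exp (γ * x)) ρ ∧
    Filter.Tendsto
      (fun x : ℝ => tail (ρ.conv ρ) x /
        (2 * (∫ y : ℝ, Real.exp (γ * y) ∂ρ) * tail ρ x))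
      Filter.atTop (nhds 1)

/-- The class `S_♯`. -/
def MemSsharp (ρ : MeasureTheory.Measure ℝ) : Prop :=
  MemOS ρ ∧
    Filter.atTop.limsup (fun A : ℝ => Filter.atTop.limsup (fun x : ℝ =>
      (tail ρ (x - A) * tail ρ A + ∫ u in Set.Ioc A (x - A), tail ρ (x - u) ∂ρ)
        / tail ρ x)) = 0

lemma conv_Ioi (μ ν : Measure ℝ) [SFinite μ] [SFinite ν] (x : ℝ) :
    (μ.conv ν) (Ioi x) = ∫⁻ y, μ (Ioi (x - y)) ∂ν := by
  rw [Measure.conv, Measure.map_apply (by fun_prop) measurableSet_Ioi,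
    Measure.prod_apply_symm (measurableSet_Ioi.preimage (by fun_prop))]
  refine lintegral_congr fun y => ?_
  congr 1
  ext z
  simp [sub_lt_iff_lt_add]

instance convPow_prob (η : Measure ℝ) [IsProbabilityMeasure η] (n : ℕ) :
    IsProbabilityMeasure (convPow η n) := by
  induction n with
  | zero => unfold convPow; infer_instance
  | succ n ih => unfold convPow; infer_instance

lemma convPow_add (η : Measure ℝ) [IsProbabilityMeasure η] (m n : ℕ) :
    convPow η (m + n) = (convPow η m).conv (convPow η n) := by
  induction n with
  | zero => simp [convPow]
  | succ n ih =>
    rw [← add_assoc, convPow, ih, convPow, Measure.conv_assoc]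

lemma convPow_mul (η : Measure ℝ) [IsProbabilityMeasure η] (m n : ℕ) :
    convPow η (m * n) = convPow (convPow η m) n := by
  induction n with
  | zero => simp [convPow]
  | succ n ih => rw [mul_add, mul_one, convPow_add, ih, convPow]

lemma convPow_one' (η : Measure ℝ) [IsProbabilityMeasure η] : convPow η 1 = η := by
  simp [convPow]

lemma convPow_mono (η : Measure ℝ) [IsProbabilityMeasure η] (h : η (Iio 0) = 0)
    (x : ℝ) {m n : ℕ} (hmn : m ≤ n) :
    convPow η m (Ioi x) ≤ convPow η n (Ioi x) := by
  induction n, hmn using Nat.le_induction with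
  | base => exact le_rfl
  | succ n _ ih =>
    refine ih.trans ?_
    rw [convPow, conv_Ioi]
    have h0 : ∀ᵐ y ∂η, 0 ≤ y := by
      rw [ae_iff]; simp only [not_le]; exact h
    calc convPow η n (Ioi x) = ∫⁻ _, convPow η n (Ioi x) ∂η := by simp
      _ ≤ _ := by
        refine lintegral_mono_ae ?_
        filter_upwards [h0] with y hy
        exact measure_mono (Ioi_subset_Ioi (by linarith))

lemma os_bound (ρ : Measure ℝ) [IsProbabilityMeasure ρ] (h : MemOS ρ) :
    ∃ M : ENNReal, M ≠ ⊤ ∧ 1 ≤ M ∧ ∀ x, (ρ.conv ρ) (Ioi x) ≤ M * ρ (Ioi x) := by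
  obtain ⟨hpos, -, hlim⟩ := h
  have e2 : convPow ρ 2 = ρ.conv ρ := by simp [convPow]
  rw [e2] at hlim
  obtain ⟨B, hB1, hB⟩ := exists_between hlim
  have hev := eventually_lt_of_limsup_lt hB1
  obtain ⟨x0, hx0⟩ := eventually_atTop.1 hev
  set x1 := max x0 1
  have hp := hpos x1 (lt_of_lt_of_le one_pos (le_max_right _ _))
  refine ⟨B + (ρ (Ioi x1))⁻¹, ?_, ?_, fun x => ?_⟩
  · simp [hB.ne, hp.ne']
  · refine le_trans ?_ le_add_self
    exact ENNReal.one_le_inv.2 prob_le_one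
  · rw [add_mul]
    rcases le_total x1 x with hx | hx
    · refine le_trans ?_ le_self_add
      have h1 := hx0 x ((le_max_left _ _).trans hx)
      have hxp := hpos x (lt_of_lt_of_le one_pos ((le_max_right _ _).trans hx))
      exact (ENNReal.div_le_iff hxp.ne' (measure_ne_top _ _)).1 h1.le
    · refine le_trans ?_ le_add_self
      refine prob_le_one.trans ?_
      rw [← ENNReal.inv_mul_cancel hp.ne' (measure_ne_top _ _)]
      gcongr

lemma os_pow (ρ : Measure ℝ) [IsProbabilityMeasure ρ] (M : ENNReal) (h1 : 1 ≤ M)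
    (hM : ∀ x, (ρ.conv ρ) (Ioi x) ≤ M * ρ (Ioi x)) (n : ℕ) (hn : 0 < n) (x : ℝ) :
    convPow ρ n (Ioi x) ≤ M ^ n * ρ (Ioi x) := by
  induction n, hn using Nat.le_induction generalizing x with
  | base =>
    rw [Nat.succ_eq_add_one, zero_add, convPow_one', pow_one]
    exact le_mul_of_one_le_left zero_le h1
  | succ n _ ih =>
    rw [convPow, conv_Ioi]
    calc ∫⁻ y, convPow ρ n (Ioi (x - y)) ∂ρ ≤ ∫⁻ y, M ^ n * ρ (Ioi (x - y)) ∂ρ :=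
          lintegral_mono fun y => ih _
      _ = M ^ n * (ρ.conv ρ) (Ioi x) := by
          rw [conv_Ioi, lintegral_const_mul]
          refine Monotone.measurable fun a b hab => ?_
          exact measure_mono (Ioi_subset_Ioi (by linarith))
      _ ≤ M ^ n * (M * ρ (Ioi x)) := by gcongr; exact hM x
      _ = _ := by rw [pow_succ, mul_assoc]

lemma conv_lower (ρ : Measure ℝ) [IsProbabilityMeasure ρ] (x a : ℝ) :
    ρ (Ioi (x - a)) * ρ (Ioi a) ≤ (ρ.conv ρ) (Ioi x) := by
  rw [conv_Ioi]
  calc ρ (Ioi (x - a)) * ρ (Ioi a) = ∫⁻ _ in Ioi a, ρ (Ioi (x - a)) ∂ρ := by simp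
    _ ≤ ∫⁻ y in Ioi a, ρ (Ioi (x - y)) ∂ρ := by
      refine setLIntegral_mono' measurableSet_Ioi fun y hy => ?_
      have : a < y := hy
      exact measure_mono (Ioi_subset_Ioi (by linarith))
    _ ≤ _ := setLIntegral_le_lintegral _ _

theorem stmt0 (η : MeasureTheory.Measure ℝ) [MeasureTheory.IsProbabilityMeasure η]
    (hconc : η (Set.Iio 0) = 0)
    (n₀ : ℕ) (hn₀ : 0 < n₀) (hOS : MemOS (convPow η n₀)) :
    (∀ a : ℝ, 0 ≤ a → ∃ C : ℝ, 0 < C ∧ ∀ x : ℝ, 0 < x →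
      tail (convPow η n₀) (x - a) ≤ C * tail (convPow η n₀) x) ∧
    (∃ K : ℝ, 1 < K ∧ ∀ n : ℕ, 0 < n → ∀ x : ℝ, 0 < x →
      tail (convPow η n) x ≤ K ^ n * tail (convPow η n₀) x) := by
  obtain ⟨M, hMt, hM1, hM⟩ := os_bound _ hOS
  have key : ∀ (ξ : Measure ℝ) (c : ENNReal) (x : ℝ), c ≠ ⊤ →
      ∀ y, ξ (Ioi y) ≤ c * convPow η n₀ (Ioi x) →
      tail ξ y ≤ c.toReal * tail (convPow η n₀) x := by
    intro ξ c x hc y h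
    unfold tail
    rw [← ENNReal.toReal_mul]
    exact ENNReal.toReal_mono (ENNReal.mul_ne_top hc (measure_ne_top _ _)) h
  constructor
  · intro a ha
    have hp : 0 < convPow η n₀ (Ioi (a + 1)) := hOS.1 _ (by linarith)
    have hc : M / convPow η n₀ (Ioi (a + 1)) ≠ ⊤ := ENNReal.div_ne_top hMt hp.ne'
    refine ⟨(M / convPow η n₀ (Ioi (a + 1))).toReal, ENNReal.toReal_pos ?_ hc, fun x _ => ?_⟩
    · exact (ENNReal.div_pos (one_pos.trans_le hM1).ne' (measure_ne_top _ _)).ne'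
    · refine key _ _ _ hc _ ?_
      rw [← ENNReal.mul_div_right_comm, ENNReal.le_div_iff_mul_le (Or.inl hp.ne')
        (Or.inl (measure_ne_top _ _))]
      refine le_trans ?_ (hM x)
      refine le_trans ?_ (conv_lower _ x a)
      gcongr
      linarith
  · have h1 : 1 ≤ M.toReal := by
      simpa using ENNReal.toReal_mono hMt hM1
    refine ⟨M.toReal + 1, by linarith, fun n hn x _ => ?_⟩
    have h2 : convPow η n (Ioi x) ≤ M ^ n * convPow η n₀ (Ioi x) := by
      refine le_trans ?_ (os_pow _ M hM1 hM n hn x)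
      rw [← convPow_mul]
      exact convPow_mono η hconc x (Nat.le_mul_of_pos_left n hn₀)
    refine (key _ _ _ (ENNReal.pow_ne_top hMt) _ h2).trans ?_
    rw [ENNReal.toReal_pow]
    refine mul_le_mul_of_nonneg_right ?_ ENNReal.toReal_nonneg
    gcongr
    linarith
end

section
/- Let ζ be a probability measure on ℝ in the class OS, and let (λ_n) be an increasing sequence with λ_n → ∞ such that for every x ∈ ℝ the limit m(x) := lim_{n→∞} tail(ζ)(λ_n − x)/tail(ζ)(λ_n) exists and is finite. Then ∫_ℝ m(x) ζ(dx) < ∞ and lim_{a→∞} m(a)·tail(ζ)(a) = 0. -/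
open MeasureTheory Filter Set

theorem stmt2 (ζ : MeasureTheory.Measure ℝ) [MeasureTheory.IsProbabilityMeasure ζ]
    (hOS : MemOS ζ) (lam : ℕ → ℝ) (hmono : StrictMono lam)
    (hlam : Filter.Tendsto lam Filter.atTop Filter.atTop)
    (m : ℝ → ℝ)
    (hm : ∀ x : ℝ, Filter.Tendsto (fun n : ℕ => tail ζ (lam n - x) / tail ζ (lam n))
      Filter.atTop (nhds (m x))) :
    MeasureTheory.Integrable m ζ ∧
      Filter.Tendsto (fun a : ℝ => m a * tail ζ a) Filter.atTop (nhds 0) := by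
  have hmeas : Measurable fun x : ℝ => ζ (Set.Ioi x) :=
    Antitone.measurable fun a b hab => measure_mono (Set.Ioi_subset_Ioi hab)
  have hmono' : Monotone m := by
    intro a b hab
    refine le_of_tendsto_of_tendsto' (hm a) (hm b) fun n => ?_
    refine div_le_div_of_nonneg_right ?_ ENNReal.toReal_nonneg
    exact ENNReal.toReal_mono (measure_ne_top _ _)
      (measure_mono (Set.Ioi_subset_Ioi (by linarith)))
  have hnn : ∀ x, 0 ≤ m x := fun x =>
    ge_of_tendsto' (hm x) fun n => div_nonneg ENNReal.toReal_nonneg ENNReal.toReal_nonneg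
  have hconv : ∀ x : ℝ, (convPow ζ 2) (Set.Ioi x) = ∫⁻ u, ζ (Set.Ioi (x - u)) ∂ζ := by
    intro x
    have h2 : convPow ζ 2 = ζ.conv ζ := by
      simp [convPow]
    rw [h2, Measure.conv, Measure.map_apply (by fun_prop) measurableSet_Ioi,
      Measure.prod_apply ((by fun_prop : Measurable fun p : ℝ × ℝ => p.1 + p.2) measurableSet_Ioi)]
    refine lintegral_congr fun u => ?_
    congr 1
    ext y
    simp [sub_lt_iff_lt_add']
  have hpos : ∀ᶠ n in atTop, 0 < ζ (Set.Ioi (lam n)) := by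
    filter_upwards [hlam.eventually_gt_atTop 0] with n hn using hOS.1 _ hn
  have hlim : ∀ u : ℝ, Tendsto (fun n => ζ (Set.Ioi (lam n - u)) / ζ (Set.Ioi (lam n)))
      atTop (nhds (ENNReal.ofReal (m u))) := by
    intro u
    refine (ENNReal.tendsto_ofReal (hm u)).congr' ?_
    filter_upwards [hpos] with n hn
    have : 0 < tail ζ (lam n) := ENNReal.toReal_pos hn.ne' (measure_ne_top _ _)
    rw [ENNReal.ofReal_div_of_pos this, tail, tail, ENNReal.ofReal_toReal (measure_ne_top _ _),
      ENNReal.ofReal_toReal (measure_ne_top _ _)]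
  have hfin : ∫⁻ u, ENNReal.ofReal (m u) ∂ζ < ⊤ := by
    obtain ⟨C, hC, hCtop⟩ := exists_between hOS.2.2
    have hev := hlam.eventually (eventually_lt_of_limsup_lt hC)
    calc ∫⁻ u, ENNReal.ofReal (m u) ∂ζ
        = ∫⁻ u, liminf (fun n => ζ (Set.Ioi (lam n - u)) / ζ (Set.Ioi (lam n))) atTop ∂ζ :=
          lintegral_congr fun u => (hlim u).liminf_eq.symm
      _ ≤ liminf (fun n => ∫⁻ u, ζ (Set.Ioi (lam n - u)) / ζ (Set.Ioi (lam n)) ∂ζ) atTop :=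
          lintegral_liminf_le fun n =>
            (hmeas.comp (measurable_const.sub measurable_id)).div_const _
      _ ≤ C := by
          refine liminf_le_of_frequently_le' (Eventually.frequently ?_)
          filter_upwards [hev] with n hn
          refine le_trans (le_of_eq ?_) hn.le
          rw [hconv]
          simp only [div_eq_mul_inv]
          exact lintegral_mul_const _ (hmeas.comp (measurable_const.sub measurable_id))
      _ < ⊤ := hCtop
  have hint : Integrable m ζ := by
    refine ⟨hmono'.measurable.aestronglyMeasurable, ?_⟩
    rw [hasFiniteIntegral_iff_ofReal (ae_of_all _ hnn)]
    exact hfin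
  refine ⟨hint, ?_⟩
  have hz : Tendsto (fun a : ℝ => ∫ x, (Set.Ioi a).indicator m x ∂ζ) atTop (nhds 0) := by
    have h0 : (0 : ℝ) = ∫ x : ℝ, (0 : ℝ) ∂ζ := by simp
    rw [h0]
    refine tendsto_integral_filter_of_dominated_convergence m ?_ ?_ hint ?_
    · exact Eventually.of_forall fun a =>
        (hmono'.measurable.indicator measurableSet_Ioi).aestronglyMeasurable
    · refine Eventually.of_forall fun a => ae_of_all _ fun x => ?_
      rw [Real.norm_of_nonneg (Set.indicator_nonneg (fun y _ => hnn y) x)]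
      exact Set.indicator_le_self' (fun y _ => hnn y) x
    · refine ae_of_all _ fun x => ?_
      refine tendsto_const_nhds.congr' ?_
      filter_upwards [eventually_ge_atTop x] with a ha
      rw [Set.indicator_of_notMem (by simpa using ha)]
  refine squeeze_zero (fun a => mul_nonneg (hnn a) ENNReal.toReal_nonneg) (fun a => ?_) hz
  have hc : m a * tail ζ a = ∫ x, (Set.Ioi a).indicator (fun _ => m a) x ∂ζ := by
    rw [integral_indicator measurableSet_Ioi, setIntegral_const, smul_eq_mul, mul_comm]
    rfl
  rw [hc]
  refine integral_mono ((integrable_const _).indicator measurableSet_Ioi)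
    (hint.indicator measurableSet_Ioi) fun x => ?_
  by_cases hx : x ∈ Set.Ioi a
  · simp only [Set.indicator_of_mem hx]
    exact hmono' (le_of_lt hx)
  · simp only [Set.indicator_of_notMem hx, le_refl]
end

section
/- Let γ ≥ 0 and let ζ be a probability measure on ℝ belonging to both the class OS and the class L(γ). Then the γ-exponential moment of ζ is finite: ∫_ℝ e^{γx} ζ(dx) < ∞. -/
open MeasureTheory Filter Set

theorem stmt3 (γ : ℝ) (hγ : 0 ≤ γ) (ζ : MeasureTheory.Measure ℝ)
    [MeasureTheory.IsProbabilityMeasure ζ] (hOS : MemOS ζ) (hL : MemL γ ζ) :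
    MeasureTheory.Integrable (fun x : ℝ => Real.exp (γ * x)) ζ := by
  obtain ⟨hpos, -, hlim⟩ := hOS
  obtain ⟨-, hL⟩ := hL
  obtain ⟨C, hC1, hC2⟩ := exists_between hlim
  have hev : ∀ᶠ x : ℝ in atTop, convPow ζ 2 (Ioi x) / ζ (Ioi x) < C :=
    eventually_lt_of_limsup_lt hC1
  have hconv : ∀ x : ℝ, convPow ζ 2 (Ioi x) = ∫⁻ y, ζ (Ioi (x - y)) ∂ζ := by
    intro x
    have h1 : convPow ζ 2 = ζ.conv ζ := by
      simp [convPow, Measure.dirac_zero_conv]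
    rw [h1, ← lintegral_indicator_one measurableSet_Ioi, Measure.lintegral_conv
      (measurable_one.indicator measurableSet_Ioi)]
    refine lintegral_congr fun y => ?_
    rw [← lintegral_indicator_one measurableSet_Ioi]
    refine lintegral_congr fun z => ?_
    simp only [indicator, mem_Ioi, sub_lt_iff_lt_add', Pi.one_apply]
  have hmeas : ∀ x : ℝ, Measurable fun y : ℝ => ζ (Ioi (x - y)) := by
    intro x
    refine Monotone.measurable fun a b hab => measure_mono (Ioi_subset_Ioi (by linarith))
  have hpt : ∀ y : ℝ, Tendsto (fun n : ℕ => ζ (Ioi ((n : ℝ) - y)) / ζ (Ioi (n : ℝ))) atTop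
      (nhds (ENNReal.ofReal (Real.exp (γ * y)))) := by
    intro y
    have h := ((hL (-y)).comp tendsto_natCast_atTop_atTop).const_mul (Real.exp (γ * y))
    have h' := ENNReal.tendsto_ofReal h
    rw [mul_one] at h'
    refine h'.congr' ?_
    filter_upwards [eventually_gt_atTop 0] with n hn
    have hp := hpos n (by exact_mod_cast hn)
    have hp' : 0 < (ζ (Ioi (n : ℝ))).toReal := ENNReal.toReal_pos hp.ne' (measure_ne_top _ _)
    have he : Real.exp (γ * y) * (tail ζ ((n : ℝ) + -y) / (Real.exp (-γ * -y) * tail ζ n))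
        = (ζ (Ioi ((n : ℝ) - y))).toReal / (ζ (Ioi (n : ℝ))).toReal := by
      rw [neg_mul_neg, ← sub_eq_add_neg]
      unfold tail
      have := Real.exp_pos (γ * y)
      field_simp
    simp only [Function.comp]
    rw [he, ENNReal.ofReal_div_of_pos hp', ENNReal.ofReal_toReal (measure_ne_top _ _),
      ENNReal.ofReal_toReal (measure_ne_top _ _)]
  have hfatou : ∫⁻ y, ENNReal.ofReal (Real.exp (γ * y)) ∂ζ ≤ C := by
    calc ∫⁻ y, ENNReal.ofReal (Real.exp (γ * y)) ∂ζ
        = ∫⁻ y, liminf (fun n : ℕ => ζ (Ioi ((n : ℝ) - y)) / ζ (Ioi (n : ℝ))) atTop ∂ζ :=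
          lintegral_congr fun y => (hpt y).liminf_eq.symm
      _ ≤ liminf (fun n : ℕ => ∫⁻ y, ζ (Ioi ((n : ℝ) - y)) / ζ (Ioi (n : ℝ)) ∂ζ) atTop :=
          lintegral_liminf_le fun n => (hmeas n).div_const _
      _ ≤ C := by
          refine liminf_le_of_frequently_le' (Eventually.frequently ?_)
          filter_upwards [tendsto_natCast_atTop_atTop.eventually hev] with n hn
          rw [hconv] at hn
          simp only [div_eq_mul_inv] at hn ⊢
          rw [lintegral_mul_const _ (hmeas n)]
          exact hn.le
  refine ⟨by fun_prop, ?_⟩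
  rw [hasFiniteIntegral_iff_ofReal (Eventually.of_forall fun x => (Real.exp_pos _).le)]
  exact hfatou.trans_lt hC2
end

section
/- Let ρ and η be probability distributions on ℝ. Suppose ρ belongs to the class S_♯, that tail(η)(x) > 0 for all x > 0, and that tail(η)(x) ≍ tail(ρ)(x). Then η belongs to the class S_♯. -/
open MeasureTheory Filter Set

open scoped ENNReal NNReal

def setE (x A : ℝ) : Set (ℝ × ℝ) := {p | A < p.1 ∧ A < p.2 ∧ x < p.1 + p.2}

lemma measurableSet_setE (x A : ℝ) : MeasurableSet (setE x A) := by
  unfold setE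
  exact (measurableSet_lt measurable_const measurable_fst).inter
    ((measurableSet_lt measurable_const measurable_snd).inter
      (measurableSet_lt measurable_const (measurable_fst.add measurable_snd)))

lemma setE_prod_le (μ η ρ : Measure ℝ) [IsProbabilityMeasure μ]
    [IsProbabilityMeasure η] [IsProbabilityMeasure ρ] (C : ℝ≥0) (x A : ℝ)
    (h : ∀ y, A ≤ y → η (Ioi y) ≤ C * ρ (Ioi y)) :
    (μ.prod η) (setE x A) ≤ C * (μ.prod ρ) (setE x A) := by
  rw [Measure.prod_apply (measurableSet_setE x A), Measure.prod_apply (measurableSet_setE x A),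
    ← lintegral_const_mul _ (measurable_measure_prodMk_left (measurableSet_setE x A))]
  refine lintegral_mono fun u => ?_
  by_cases hu : A < u
  · have : Prod.mk u ⁻¹' setE x A = Ioi (max A (x - u)) := by
      ext v
      simp only [setE, mem_preimage, mem_setOf_eq, mem_Ioi, max_lt_iff]
      constructor
      · rintro ⟨_, h1, h2⟩; exact ⟨h1, by linarith⟩
      · rintro ⟨h1, h2⟩; exact ⟨hu, h1, by linarith⟩
    simp only [this]
    exact h _ (le_max_left _ _)
  · have : Prod.mk u ⁻¹' setE x A = ∅ := by
      ext v; simp [setE, hu]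
    simp [this]

lemma setE_swap (μ ν : Measure ℝ) [IsProbabilityMeasure μ] [IsProbabilityMeasure ν] (x A : ℝ) :
    (μ.prod ν) (setE x A) = (ν.prod μ) (setE x A) := by
  rw [← Measure.prod_swap, Measure.map_apply measurable_swap (measurableSet_setE x A)]
  congr 1
  ext p
  simp only [setE, mem_preimage, mem_setOf_eq, Prod.fst_swap, Prod.snd_swap]
  rw [add_comm p.2]; tauto

lemma setE_le (η ρ : Measure ℝ)
    [IsProbabilityMeasure η] [IsProbabilityMeasure ρ] (C : ℝ≥0) (x A : ℝ)
    (h : ∀ y, A ≤ y → η (Ioi y) ≤ C * ρ (Ioi y)) :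
    (η.prod η) (setE x A) ≤ (C * C : ℝ≥0) * (ρ.prod ρ) (setE x A) := by
  calc (η.prod η) (setE x A) ≤ C * (η.prod ρ) (setE x A) := setE_prod_le _ _ _ _ _ _ h
    _ = C * (ρ.prod η) (setE x A) := by rw [setE_swap]
    _ ≤ C * (C * (ρ.prod ρ) (setE x A)) := by gcongr; exact setE_prod_le _ _ _ _ _ _ h
    _ = _ := by push_cast; ring

lemma convPow_two_Ioi (ρ : Measure ℝ) [IsProbabilityMeasure ρ] (x : ℝ) :
    convPow ρ 2 (Ioi x) = (ρ.prod ρ) {p | x < p.1 + p.2} := by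
  have : convPow ρ 2 = ρ.conv ρ := by
    simp [convPow]
  rw [this, Measure.conv, Measure.map_apply (by fun_prop) measurableSet_Ioi]
  rfl

lemma setE_le_conv (ρ : Measure ℝ) [IsProbabilityMeasure ρ] (x A : ℝ) :
    (ρ.prod ρ) (setE x A) ≤ convPow ρ 2 (Ioi x) := by
  rw [convPow_two_Ioi]
  exact measure_mono fun p hp => hp.2.2

lemma mul_le_conv (ρ : Measure ℝ) [IsProbabilityMeasure ρ] (x A : ℝ) :
    ρ (Ioi (x - A)) * ρ (Ioi A) ≤ convPow ρ 2 (Ioi x) := by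
  rw [convPow_two_Ioi, ← Measure.prod_prod]
  refine measure_mono fun p hp => ?_
  have h1 : x - A < p.1 := hp.1
  have h2 : A < p.2 := hp.2
  show x < p.1 + p.2
  linarith

lemma conv_le (η : Measure ℝ) [IsProbabilityMeasure η] (x A : ℝ) :
    convPow η 2 (Ioi x) ≤ (η.prod η) (setE x A) + (η (Ioi (x - A)) + η (Ioi (x - A))) := by
  rw [convPow_two_Ioi]
  have e1 : η (Ioi (x - A)) = (η.prod η) (univ ×ˢ Ioi (x - A)) := by
    rw [Measure.prod_prod]; simp
  have e2 : η (Ioi (x - A)) = (η.prod η) (Ioi (x - A) ×ˢ univ) := by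
    rw [Measure.prod_prod]; simp
  calc _ ≤ (η.prod η) (setE x A ∪ (univ ×ˢ Ioi (x - A) ∪ Ioi (x - A) ×ˢ univ)) := by
        refine measure_mono fun p hp => ?_
        have hp : x < p.1 + p.2 := hp
        simp only [setE, mem_union, mem_setOf_eq, mem_prod, mem_univ, mem_Ioi, true_and, and_true]
        by_cases h1 : A < p.1
        · by_cases h2 : A < p.2
          · exact Or.inl ⟨h1, h2, hp⟩
          · right; right; linarith
        · right; left; linarith
    _ ≤ _ := (measure_union_le _ _).trans (add_le_add le_rfl (measure_union_le _ _))
    _ = _ := by rw [← e1, ← e2]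

lemma expr_eq (ρ : Measure ℝ) [IsProbabilityMeasure ρ] (x A : ℝ) (hx : 2 * A ≤ x) :
    tail ρ (x - A) * tail ρ A + ∫ u in Set.Ioc A (x - A), tail ρ (x - u) ∂ρ
      = ((ρ.prod ρ) (setE x A)).toReal := by
  have hm : Measurable fun u => ρ (Ioi (x - u)) := by
    apply Monotone.measurable
    intro a b hab
    exact measure_mono (Ioi_subset_Ioi (by linarith))
  have hS : MeasurableSet {p : ℝ × ℝ | p.1 ∈ Ioc A (x - A) ∧ x < p.1 + p.2} :=
    (measurable_fst measurableSet_Ioc).inter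
      (measurableSet_lt measurable_const (measurable_fst.add measurable_snd))
  have hE : setE x A = (Ioi (x - A) ×ˢ Ioi A) ∪ {p | p.1 ∈ Ioc A (x - A) ∧ x < p.1 + p.2} := by
    ext p
    simp only [setE, mem_union, mem_setOf_eq, mem_prod, mem_Ioi, mem_Ioc]
    constructor
    · rintro ⟨h1, h2, h3⟩
      by_cases h : x - A < p.1
      · exact Or.inl ⟨h, h2⟩
      · exact Or.inr ⟨⟨h1, not_lt.1 h⟩, h3⟩
    · rintro (⟨h1, h2⟩ | ⟨⟨h1, h2⟩, h3⟩)
      · exact ⟨by linarith, h2, by linarith⟩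
      · exact ⟨h1, by linarith, h3⟩
  have hd : Disjoint (Ioi (x - A) ×ˢ Ioi A)
      {p : ℝ × ℝ | p.1 ∈ Ioc A (x - A) ∧ x < p.1 + p.2} := by
    rw [Set.disjoint_left]
    rintro p ⟨h1, _⟩ ⟨h2, _⟩
    exact absurd h2.2 (not_le.2 h1)
  have hI : (ρ.prod ρ) {p : ℝ × ℝ | p.1 ∈ Ioc A (x - A) ∧ x < p.1 + p.2}
      = ∫⁻ u in Ioc A (x - A), ρ (Ioi (x - u)) ∂ρ := by
    rw [Measure.prod_apply hS, ← lintegral_indicator measurableSet_Ioc]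
    congr 1
    ext u
    by_cases hu : u ∈ Ioc A (x - A)
    · rw [indicator_of_mem hu]
      congr 1
      ext v
      simp only [mem_preimage, mem_setOf_eq, hu, true_and, mem_Ioi]
      exact ⟨fun h => by linarith, fun h => by linarith⟩
    · rw [indicator_of_notMem hu]
      have : Prod.mk u ⁻¹' {p : ℝ × ℝ | p.1 ∈ Ioc A (x - A) ∧ x < p.1 + p.2} = ∅ := by
        ext v; simp only [mem_preimage, mem_setOf_eq, hu, false_and, mem_empty_iff_false]
      rw [this, measure_empty]
  rw [hE, measure_union hd hS, ENNReal.toReal_add (measure_ne_top _ _) (measure_ne_top _ _),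
    Measure.prod_prod, ENNReal.toReal_mul, hI]
  unfold tail
  rw [integral_toReal hm.aemeasurable]
  exact Eventually.of_forall fun u => measure_lt_top _ _

lemma limA (q : ℝ → ℝ → ℝ) (K : ℝ) (h : ∀ A, ∀ᶠ x in atTop, 0 ≤ q A x ∧ q A x ≤ K)
    (h0 : atTop.limsup (fun A : ℝ => atTop.limsup (fun x : ℝ => q A x)) = 0) (ε : ℝ)
    (hε : 0 < ε) : ∀ᶠ A in atTop, ∀ᶠ x in atTop, q A x < ε := by
  have hb : ∀ A, IsBoundedUnder (· ≤ ·) atTop (fun x => q A x) := fun A =>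
    isBoundedUnder_of_eventually_le ((h A).mono fun x hx => hx.2)
  have hc : ∀ A, IsCoboundedUnder (· ≤ ·) atTop (fun x => q A x) := fun A =>
    isCoboundedUnder_le_of_eventually_le _ ((h A).mono fun x hx => hx.1)
  have hf : ∀ A, atTop.limsup (fun x : ℝ => q A x) ≤ K := fun A =>
    limsup_le_of_le (hc A) ((h A).mono fun x hx => hx.2)
  have := eventually_lt_of_limsup_lt (h0.trans_lt hε)
    (isBoundedUnder_of_eventually_le (Eventually.of_forall hf))
  filter_upwards [this] with A hA
  exact eventually_lt_of_limsup_lt hA (hb A)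

lemma limB (q : ℝ → ℝ → ℝ) (h : ∀ A, ∀ᶠ x in atTop, 0 ≤ q A x)
    (h0 : ∀ ε > 0, ∀ᶠ A in atTop, ∀ᶠ x in atTop, q A x ≤ ε) :
    atTop.limsup (fun A : ℝ => atTop.limsup (fun x : ℝ => q A x)) = 0 := by
  apply Tendsto.limsup_eq
  rw [Metric.tendsto_nhds]
  intro ε hε
  filter_upwards [h0 (ε / 2) (by linarith)] with A hA
  have hc : IsCoboundedUnder (· ≤ ·) atTop (fun x => q A x) :=
    isCoboundedUnder_le_of_eventually_le _ (h A)
  have h1 : atTop.limsup (fun x : ℝ => q A x) ≤ ε / 2 := limsup_le_of_le hc hA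
  have h2 : 0 ≤ atTop.limsup (fun x : ℝ => q A x) :=
    le_limsup_of_frequently_le (h A).frequently (isBoundedUnder_of_eventually_le hA)
  rw [Real.dist_eq, sub_zero, abs_of_nonneg h2]
  linarith

lemma upper_of_limsup (ξ ζ : Measure ℝ) [IsFiniteMeasure ζ]
    (hζ : ∀ x : ℝ, 0 < x → 0 < ζ (Ioi x))
    (h : atTop.limsup (fun x : ℝ => ξ (Set.Ioi x) / ζ (Set.Ioi x)) < ⊤) :
    ∃ C : ℝ≥0, ∀ᶠ x in atTop, ξ (Ioi x) ≤ C * ζ (Ioi x) := by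
  obtain ⟨C, hC1, hC2⟩ := ENNReal.lt_iff_exists_nnreal_btwn.1 h
  refine ⟨C, ?_⟩
  filter_upwards [eventually_lt_of_limsup_lt hC1, eventually_gt_atTop 0] with x hx h0
  exact (ENNReal.div_le_iff (hζ x h0).ne' (measure_ne_top _ _)).1 hx.le

lemma lower_of_liminf (ξ ζ : Measure ℝ) [IsFiniteMeasure ζ]
    (hζ : ∀ x : ℝ, 0 < x → 0 < ζ (Ioi x))
    (h : 0 < atTop.liminf (fun x : ℝ => ξ (Set.Ioi x) / ζ (Set.Ioi x))) :
    ∃ c : ℝ≥0, 0 < c ∧ ∀ᶠ x in atTop, ζ (Ioi x) ≤ c * ξ (Ioi x) := by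
  obtain ⟨c, hC1, hC2⟩ := ENNReal.lt_iff_exists_nnreal_btwn.1 h
  have hc : 0 < c := by exact_mod_cast hC1
  refine ⟨c⁻¹, by positivity, ?_⟩
  filter_upwards [eventually_lt_of_lt_liminf hC2, eventually_gt_atTop 0] with x hx h0
  have := (ENNReal.le_div_iff_mul_le (Or.inl (hζ x h0).ne') (Or.inl (measure_ne_top _ _))).1 hx.le
  calc ζ (Ioi x) = (c⁻¹ : ℝ≥0) * (c * ζ (Ioi x)) := by
        rw [← mul_assoc, ← ENNReal.coe_mul, inv_mul_cancel₀ hc.ne']; simp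
    _ ≤ _ := by gcongr

theorem stmt4 (ρ η : MeasureTheory.Measure ℝ)
    [MeasureTheory.IsProbabilityMeasure ρ] [MeasureTheory.IsProbabilityMeasure η]
    (hρ : MemSsharp ρ) (hη : ∀ x : ℝ, 0 < x → 0 < η (Set.Ioi x))
    (hasymp : TailAsymp η ρ) :
    MemSsharp η := by
  obtain ⟨⟨hρ0, hρ1⟩, hρ2⟩ := hρ
  obtain ⟨K, hK⟩ := upper_of_limsup _ _ hρ0 hρ1.2
  obtain ⟨C, hC⟩ := upper_of_limsup _ _ hρ0 hasymp.2
  obtain ⟨c, hc0, hc⟩ := lower_of_liminf _ _ hρ0 hasymp.1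
  obtain ⟨x0, hx0⟩ := eventually_atTop.1 hC
  refine ⟨⟨hη, ?_, ?_⟩, ?_⟩
  · refine lt_of_lt_of_le (hη 1 one_pos) (le_liminf_of_le (by isBoundedDefault) ?_)
    filter_upwards [eventually_gt_atTop 0] with x hx
    rw [ENNReal.le_div_iff_mul_le (Or.inl (hη x hx).ne') (Or.inl (measure_ne_top _ _)), mul_comm]
    refine le_trans ?_ (mul_le_conv η x 1)
    gcongr
    linarith
  · set A := max x0 1 with hA
    have hA0 : 0 < A := lt_of_lt_of_le one_pos (le_max_right _ _)
    obtain ⟨t, ht⟩ : ∃ t : ℝ≥0, (t : ℝ≥0∞) = (ρ (Ioi A))⁻¹ :=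
      ⟨_, ENNReal.coe_toNNReal (ENNReal.inv_ne_top.2 (hρ0 A hA0).ne')⟩
    let M : ℝ≥0 := C * C * K * c + (C * (K * t) * c + C * (K * t) * c)
    refine lt_of_le_of_lt (b := (M : ℝ≥0∞)) ?_ ENNReal.coe_lt_top
    refine limsup_le_of_le (by isBoundedDefault) ?_
    filter_upwards [hK, hc, eventually_gt_atTop 0, eventually_ge_atTop (x0 + A)] with x h1 h2 h3 h4
    rw [ENNReal.div_le_iff (hη x h3).ne' (measure_ne_top _ _)]
    have hE : (η.prod η) (setE x A) ≤ (C * C * K * c : ℝ≥0) * η (Ioi x) := by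
      calc _ ≤ (C * C : ℝ≥0) * (ρ.prod ρ) (setE x A) :=
            setE_le _ _ _ _ _ fun y hy => hx0 y ((le_max_left _ _).trans hy)
        _ ≤ (C * C : ℝ≥0) * (K * (c * η (Ioi x))) := by
            gcongr
            exact (setE_le_conv ρ x A).trans (h1.trans (by gcongr))
        _ = _ := by push_cast; ring
    have hT : η (Ioi (x - A)) ≤ (C * (K * t) * c : ℝ≥0) * η (Ioi x) := by
      have h5 : ρ (Ioi (x - A)) ≤ t * (K * ρ (Ioi x)) := by
        calc ρ (Ioi (x - A)) = t * (ρ (Ioi (x - A)) * ρ (Ioi A)) := by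
              rw [ht, mul_comm, mul_assoc, ENNReal.mul_inv_cancel (hρ0 A hA0).ne'
                (measure_ne_top _ _), mul_one]
          _ ≤ _ := mul_le_mul_right ((mul_le_conv ρ x A).trans h1) _
      calc _ ≤ C * ρ (Ioi (x - A)) := hx0 _ (by linarith)
        _ ≤ C * (t * (K * (c * η (Ioi x)))) := by
            gcongr; exact h5.trans (by gcongr)
        _ = _ := by push_cast; ring
    refine (conv_le η x A).trans ((add_le_add hE (add_le_add hT hT)).trans (le_of_eq ?_))
    simp only [M]; push_cast; ring
  · have key : ∀ A, ∀ᶠ x in atTop, 0 ≤ (tail ρ (x - A) * tail ρ A +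
        ∫ u in Set.Ioc A (x - A), tail ρ (x - u) ∂ρ) / tail ρ x ∧ (tail ρ (x - A) * tail ρ A +
        ∫ u in Set.Ioc A (x - A), tail ρ (x - u) ∂ρ) / tail ρ x ≤ (K : ℝ) := by
      intro A
      filter_upwards [hK, eventually_gt_atTop 0, eventually_ge_atTop (2 * A)] with x h1 h2 h3
      rw [expr_eq _ _ _ h3]
      have hp : 0 < tail ρ x := ENNReal.toReal_pos (hρ0 x h2).ne' (measure_ne_top _ _)
      refine ⟨by positivity, ?_⟩
      rw [div_le_iff₀ hp]
      have := ENNReal.toReal_mono (ENNReal.mul_ne_top ENNReal.coe_ne_top (measure_ne_top _ _))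
        ((setE_le_conv ρ x A).trans h1)
      simpa [tail] using this
    apply limB
    · intro A
      filter_upwards [eventually_ge_atTop (2 * A)] with x h3
      rw [expr_eq _ _ _ h3]
      exact div_nonneg ENNReal.toReal_nonneg ENNReal.toReal_nonneg
    · intro ε hε
      have hM : (0 : ℝ) < C * C * c + 1 := by positivity
      filter_upwards [limA _ _ key hρ2 (ε / (C * C * c + 1)) (by positivity),
        eventually_ge_atTop x0] with A hA hA0
      filter_upwards [hA, hc, eventually_gt_atTop 0, eventually_ge_atTop (2 * A)] with x h1 h2 h3 h4
      rw [expr_eq _ _ _ h4] at h1 ⊢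
      have hp : 0 < tail ρ x := ENNReal.toReal_pos (hρ0 x h3).ne' (measure_ne_top _ _)
      have hq : 0 < tail η x := ENNReal.toReal_pos (hη x h3).ne' (measure_ne_top _ _)
      have e1 := ENNReal.toReal_mono (ENNReal.mul_ne_top ENNReal.coe_ne_top (measure_ne_top _ _))
        (setE_le η ρ C x A fun y hy => hx0 y (hA0.trans hy))
      have e2 := ENNReal.toReal_mono (ENNReal.mul_ne_top ENNReal.coe_ne_top (measure_ne_top _ _)) h2
      rw [ENNReal.toReal_mul, ENNReal.coe_toReal] at e1 e2
      push_cast at e1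
      change tail ρ x ≤ c * tail η x at e2
      rw [div_lt_iff₀ hp] at h1
      rw [div_le_iff₀ hq]
      calc _ ≤ (C * C : ℝ) * (ε / (C * C * c + 1) * (c * tail η x)) := by
            refine e1.trans ?_
            gcongr
            exact h1.le.trans (by gcongr)
        _ = (C * C * c / (C * C * c + 1)) * (ε * tail η x) := by ring
        _ ≤ 1 * (ε * tail η x) := by
            gcongr
            rw [div_le_one hM]; linarith
        _ = _ := one_mul _
end

section
/- Let γ ≥ 0, let ζ be a probability measure on ℝ in the class OS, and for j = 1, 2 let ρ_j be probability distributions concentrated on [0,∞) such that tail(ρ_j)(x) ≤ C_j · tail(ζ)(x) for all x > 0, with some constants C_j > 0. Suppose that for j = 1, 2 and every a ≥ 0, lim_{x→∞} (e^{−γa}·tail(ρ_j)(x−a) − tail(ρ_j)(x)) / tail(ζ)(x) = 0. Then for every a ≥ 0, lim_{x→∞} (e^{−γa}·tail(ρ_1*ρ_2)(x−a) − tail(ρ_1*ρ_2)(x)) / tail(ζ)(x) = 0, where ρ_1*ρ_2 denotes the convolution of ρ_1 and ρ_2. -/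
open MeasureTheory Filter Set

lemma tail_nonneg6 (μ : Measure ℝ) (x : ℝ) : 0 ≤ tail μ x := ENNReal.toReal_nonneg

lemma tail_anti6 (μ : Measure ℝ) [IsProbabilityMeasure μ] : Antitone (tail μ) := by
  intro x y h
  exact ENNReal.toReal_mono (measure_ne_top _ _) (measure_mono (Ioi_subset_Ioi h))

lemma tail_le_one6 (μ : Measure ℝ) [IsProbabilityMeasure μ] (x : ℝ) : tail μ x ≤ 1 :=
  ENNReal.toReal_le_of_le_ofReal zero_le_one (by simpa using prob_le_one)

lemma tail_meas6 (μ : Measure ℝ) [IsProbabilityMeasure μ] : Measurable (tail μ) :=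
  (tail_anti6 μ).measurable

lemma integrable6 (ν : Measure ℝ) [IsProbabilityMeasure ν] {f : ℝ → ℝ} (hf : Measurable f)
    (C : ℝ) (h : ∀ x, |f x| ≤ C) : Integrable f ν :=
  Integrable.of_bound hf.aestronglyMeasurable C (Eventually.of_forall h)

lemma prod_real6 (μ ν : Measure ℝ) [IsProbabilityMeasure μ] [IsProbabilityMeasure ν]
    {s : Set (ℝ × ℝ)} (hs : MeasurableSet s) :
    (μ.prod ν s).toReal = ∫ u, (ν (Prod.mk u ⁻¹' s)).toReal ∂μ := by
  rw [integral_toReal (measurable_measure_prodMk_left hs).aemeasurable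
    (Eventually.of_forall fun _ => measure_lt_top _ _), Measure.prod_apply hs]

lemma prod_real_symm6 (μ ν : Measure ℝ) [IsProbabilityMeasure μ] [IsProbabilityMeasure ν]
    {s : Set (ℝ × ℝ)} (hs : MeasurableSet s) :
    (μ.prod ν s).toReal = ∫ v, (μ ((fun u => (u, v)) ⁻¹' s)).toReal ∂ν := by
  rw [integral_toReal (measurable_measure_prodMk_right hs).aemeasurable
    (Eventually.of_forall fun _ => measure_lt_top _ _), Measure.prod_apply_symm hs]

lemma tail_conv_prod6 (μ ν : Measure ℝ) [IsProbabilityMeasure μ] [IsProbabilityMeasure ν]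
    (x : ℝ) : tail (μ.conv ν) x = (μ.prod ν {p | x < p.1 + p.2}).toReal := by
  unfold tail Measure.conv
  rw [Measure.map_apply (by fun_prop) measurableSet_Ioi]
  rfl

lemma tail_conv_left6 (μ ν : Measure ℝ) [IsProbabilityMeasure μ] [IsProbabilityMeasure ν]
    (x : ℝ) : tail (μ.conv ν) x = ∫ u, tail ν (x - u) ∂μ := by
  rw [tail_conv_prod6, prod_real6 _ _ (measurableSet_lt (by fun_prop) (by fun_prop))]
  refine integral_congr_ae (Eventually.of_forall fun u => ?_)
  simp only [tail]
  congr 2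
  ext v
  simp [sub_lt_iff_lt_add']

lemma tail_conv_right6 (μ ν : Measure ℝ) [IsProbabilityMeasure μ] [IsProbabilityMeasure ν]
    (x : ℝ) : tail (μ.conv ν) x = ∫ v, tail μ (x - v) ∂ν := by
  rw [tail_conv_prod6, prod_real_symm6 _ _ (measurableSet_lt (by fun_prop) (by fun_prop))]
  refine integral_congr_ae (Eventually.of_forall fun u => ?_)
  simp only [tail]
  congr 2
  ext v
  simp [sub_lt_iff_lt_add]

/-- The part of the convolution tail with second variable at most `x - A`. -/
noncomputable def F6 (μ ν : Measure ℝ) (x A : ℝ) : ℝ :=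
  ∫ v, (if v ≤ x - A then tail μ (x - v) else 0) ∂ν

/-- The part of the convolution tail with second variable greater than `x - A`. -/
noncomputable def G6 (μ ν : Measure ℝ) (x A : ℝ) : ℝ :=
  ∫ u, tail ν (max (x - u) (x - A)) ∂μ

lemma split6 (μ ν : Measure ℝ) [IsProbabilityMeasure μ] [IsProbabilityMeasure ν]
    (x A : ℝ) : tail (μ.conv ν) x = F6 μ ν x A + G6 μ ν x A := by
  have hm1 : MeasurableSet {p : ℝ × ℝ | x < p.1 + p.2} :=
    measurableSet_lt (by fun_prop) (by fun_prop)
  have hm2 : MeasurableSet {p : ℝ × ℝ | p.2 ≤ x - A} :=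
    measurableSet_le (by fun_prop) (by fun_prop)
  have e : {p : ℝ × ℝ | x < p.1 + p.2} = ({p : ℝ × ℝ | x < p.1 + p.2} ∩ {p | p.2 ≤ x - A}) ∪
      ({p : ℝ × ℝ | x < p.1 + p.2} \ {p | p.2 ≤ x - A}) := (inter_union_sdiff _ _).symm
  rw [tail_conv_prod6, e, measure_union (disjoint_sdiff_right.mono_left inter_subset_right)
    (hm1.diff hm2), ENNReal.toReal_add (measure_ne_top _ _) (measure_ne_top _ _)]
  congr 1
  · rw [prod_real_symm6 _ _ (hm1.inter hm2)]
    refine integral_congr_ae (Eventually.of_forall fun v => ?_)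
    simp only [tail]
    split_ifs with h
    · congr 2
      ext u
      simp [sub_lt_iff_lt_add, h]
    · have : (fun u => (u, v)) ⁻¹' ({p : ℝ × ℝ | x < p.1 + p.2} ∩ {p | p.2 ≤ x - A}) = ∅ := by
        ext u
        simp only [mem_preimage, mem_inter_iff, mem_ofPred_eq, mem_empty_iff_false]
        tauto
      rw [this]; simp
  · rw [prod_real6 _ _ (hm1.diff hm2)]
    refine integral_congr_ae (Eventually.of_forall fun u => ?_)
    simp only [tail]
    congr 2
    ext v
    simp [sub_lt_iff_lt_add']

lemma F6_meas (μ : Measure ℝ) [IsProbabilityMeasure μ] (x A : ℝ) :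
    Measurable (fun v => if v ≤ x - A then tail μ (x - v) else 0) :=
  Measurable.ite (measurableSet_le (by fun_prop) (by fun_prop))
    ((tail_meas6 μ).comp (by fun_prop)) measurable_const

lemma F6_int (μ ν : Measure ℝ) [IsProbabilityMeasure μ] [IsProbabilityMeasure ν] (x A : ℝ) :
    Integrable (fun v => if v ≤ x - A then tail μ (x - v) else 0) ν := by
  refine integrable6 ν (F6_meas μ x A) 1 fun v => ?_
  split_ifs
  · rw [abs_of_nonneg (tail_nonneg6 _ _)]; exact tail_le_one6 _ _
  · simp

lemma tail_int6 (μ ν : Measure ℝ) [IsProbabilityMeasure μ] [IsProbabilityMeasure ν]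
    {f : ℝ → ℝ} (hf : Measurable f) :
    Integrable (fun v => tail μ (f v)) ν := by
  refine integrable6 ν ((tail_meas6 μ).comp hf) 1 fun v => ?_
  rw [abs_of_nonneg (tail_nonneg6 _ _)]; exact tail_le_one6 _ _

lemma F6_nonneg (μ ν : Measure ℝ) (x A : ℝ) : 0 ≤ F6 μ ν x A := by
  refine integral_nonneg fun v => ?_
  simp only [Pi.zero_apply]
  split_ifs
  · exact tail_nonneg6 _ _
  · exact le_rfl

lemma G6_nonneg (μ ν : Measure ℝ) (x A : ℝ) : 0 ≤ G6 μ ν x A :=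
  integral_nonneg fun _ => tail_nonneg6 _ _

lemma F6_diff (μ ν ζ : Measure ℝ) [IsProbabilityMeasure μ] [IsProbabilityMeasure ν]
    [IsProbabilityMeasure ζ] (e a A ε x : ℝ) (ha : 0 ≤ a) (hε : 0 ≤ ε)
    (h : ∀ z, A ≤ z → |e * tail μ (z - a) - tail μ z| ≤ ε * tail ζ z) :
    |e * F6 μ ν (x - a) A - F6 μ ν x (A + a)| ≤ ε * tail (ζ.conv ν) x := by
  rw [tail_conv_right6]
  unfold F6
  rw [← integral_const_mul, ← integral_const_mul,
    ← integral_sub ((F6_int μ ν _ _).const_mul _) (F6_int μ ν _ _), ← Real.norm_eq_abs]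
  refine norm_integral_le_of_norm_le ((tail_int6 ζ ν (by fun_prop)).const_mul _)
    (Eventually.of_forall fun v => ?_)
  rw [Real.norm_eq_abs]
  have e1 : x - (A + a) = x - a - A := by ring
  rw [e1]
  split_ifs with hv
  · have := h (x - v) (by linarith)
    rwa [show x - a - v = x - v - a by ring]
  · simpa using mul_nonneg hε (tail_nonneg6 _ _)

lemma G6_diff (μ ν ζ : Measure ℝ) [IsProbabilityMeasure μ] [IsProbabilityMeasure ν]
    [IsProbabilityMeasure ζ] (e a A ε x : ℝ) (hε : 0 ≤ ε)
    (h : ∀ z, x - A ≤ z → |e * tail ν (z - a) - tail ν z| ≤ ε * tail ζ z) :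
    |e * G6 μ ν (x - a) A - G6 μ ν x A| ≤ ε * tail ζ (x - A) := by
  unfold G6
  rw [← integral_const_mul,
    ← integral_sub ((tail_int6 ν μ (by fun_prop)).const_mul _) (tail_int6 ν μ (by fun_prop)),
    ← Real.norm_eq_abs]
  refine (norm_integral_le_of_norm_le_const (μ := μ) (C := ε * tail ζ (x - A))
    (Eventually.of_forall fun u => ?_)).trans (by simp)
  rw [Real.norm_eq_abs]
  have e1 : max (x - a - u) (x - a - A) = max (x - u) (x - A) - a := by
    rw [← max_sub_sub_right]; congr 1 <;> ring
  rw [e1]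
  exact (h _ (le_max_right _ _)).trans
    (mul_le_mul_of_nonneg_left (tail_anti6 ζ (le_max_right _ _)) hε)

lemma littleo6 {f T : ℝ → ℝ} (hT : ∀ x, 0 < T x) :
    Tendsto (fun x => f x / T x) atTop (nhds 0) ↔
      ∀ ε > 0, ∀ᶠ x in atTop, |f x| ≤ ε * T x := by
  constructor
  · intro h ε hε
    filter_upwards [(Metric.tendsto_nhds.1 h) ε hε] with x hx
    rw [Real.dist_eq, sub_zero, abs_div, abs_of_pos (hT x), div_lt_iff₀ (hT x)] at hx
    exact hx.le
  · intro h
    rw [Metric.tendsto_nhds]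
    intro ε hε
    filter_upwards [h (ε / 2) (by positivity)] with x hx
    rw [Real.dist_eq, sub_zero, abs_div, abs_of_pos (hT x), div_lt_iff₀ (hT x)]
    have := mul_pos hε (hT x)
    linarith

lemma os_bound6 (ζ : Measure ℝ) [IsProbabilityMeasure ζ] (hOS : MemOS ζ) :
    ∃ K : ℝ, 0 < K ∧ ∀ᶠ x in atTop, tail (ζ.conv ζ) x ≤ K * tail ζ x := by
  have h2 : convPow ζ 2 = ζ.conv ζ := by
    simp [convPow]
  obtain ⟨hp, -, hl⟩ := hOS
  rw [h2] at hl
  obtain ⟨b, hb1, hb2⟩ := exists_between hl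
  have hbt : b ≠ ⊤ := hb2.ne
  refine ⟨b.toReal + 1, by positivity, ?_⟩
  filter_upwards [eventually_lt_of_limsup_lt hb1, eventually_gt_atTop 0] with x hx hx0
  have h3 : (ζ.conv ζ) (Ioi x) ≤ b * ζ (Ioi x) :=
    (ENNReal.div_le_iff (hp x hx0).ne' (measure_ne_top _ _)).1 hx.le
  have h4 := ENNReal.toReal_mono (ENNReal.mul_ne_top hbt (measure_ne_top _ _)) h3
  rw [ENNReal.toReal_mul] at h4
  have := tail_nonneg6 ζ x
  unfold tail at *
  nlinarith

lemma shift6 (ζ : Measure ℝ) [IsProbabilityMeasure ζ] (x A : ℝ) :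
    tail ζ A * tail ζ (x - A) ≤ tail (ζ.conv ζ) x := by
  rw [tail_conv_prod6]
  unfold tail
  rw [← ENNReal.toReal_mul, ← Measure.prod_prod]
  refine ENNReal.toReal_mono (measure_ne_top _ _) (measure_mono ?_)
  rintro ⟨u, v⟩ ⟨h1, h2⟩
  simp only [mem_Ioi, mem_ofPred_eq] at *
  linarith

lemma dom6 (ζ ρ : Measure ℝ) [IsProbabilityMeasure ζ] [IsProbabilityMeasure ρ]
    (hT : ∀ x, 0 < tail ζ x) (C : ℝ) (hC : 0 < C)
    (hb : ∀ x : ℝ, 0 < x → tail ρ x ≤ C * tail ζ x) :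
    ∃ C' : ℝ, 0 < C' ∧ ∀ x, tail ρ x ≤ C' * tail ζ x := by
  refine ⟨C + 1 / tail ζ 0, by have := hT 0; positivity, fun x => ?_⟩
  have h0 := hT 0
  have hx := hT x
  rcases lt_or_ge 0 x with h | h
  · have := hb x h
    have : 0 < 1 / tail ζ 0 * tail ζ x := by positivity
    linarith
  · have h1 := tail_anti6 ζ h
    have h2 : 1 ≤ 1 / tail ζ 0 * tail ζ x := by
      rw [div_mul_eq_mul_div, le_div_iff₀ h0]; linarith
    have := tail_le_one6 ρ x
    have : 0 < C * tail ζ x := by positivity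
    linarith

theorem stmt6 (γ : ℝ) (hγ : 0 ≤ γ) (ζ : MeasureTheory.Measure ℝ)
    [MeasureTheory.IsProbabilityMeasure ζ] (hOS : MemOS ζ)
    (ρ₁ ρ₂ : MeasureTheory.Measure ℝ)
    [MeasureTheory.IsProbabilityMeasure ρ₁] [MeasureTheory.IsProbabilityMeasure ρ₂]
    (hc₁ : ρ₁ (Set.Iio 0) = 0) (hc₂ : ρ₂ (Set.Iio 0) = 0)
    (C₁ C₂ : ℝ) (hC₁ : 0 < C₁) (hC₂ : 0 < C₂)
    (hb₁ : ∀ x : ℝ, 0 < x → tail ρ₁ x ≤ C₁ * tail ζ x)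
    (hb₂ : ∀ x : ℝ, 0 < x → tail ρ₂ x ≤ C₂ * tail ζ x)
    (h₁ : ∀ a : ℝ, 0 ≤ a → Filter.Tendsto
      (fun x : ℝ => (Real.exp (-γ * a) * tail ρ₁ (x - a) - tail ρ₁ x) / tail ζ x)
      Filter.atTop (nhds 0))
    (h₂ : ∀ a : ℝ, 0 ≤ a → Filter.Tendsto
      (fun x : ℝ => (Real.exp (-γ * a) * tail ρ₂ (x - a) - tail ρ₂ x) / tail ζ x)
      Filter.atTop (nhds 0)) :
    ∀ a : ℝ, 0 ≤ a → Filter.Tendsto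
      (fun x : ℝ => (Real.exp (-γ * a) * tail (ρ₁.conv ρ₂) (x - a) - tail (ρ₁.conv ρ₂) x)
        / tail ζ x) Filter.atTop (nhds 0) := by
  intro a ha
  have hT : ∀ x, 0 < tail ζ x := by
    intro x
    have h1 : 0 < ζ (Ioi (max x 1)) := hOS.1 _ (by positivity)
    exact (ENNReal.toReal_pos h1.ne' (measure_ne_top _ _)).trans_le
      (tail_anti6 ζ (le_max_left x 1))
  obtain ⟨K, hK, hKb⟩ := os_bound6 ζ hOS
  obtain ⟨D₁, hD₁, hd₁⟩ := dom6 ζ ρ₁ hT C₁ hC₁ hb₁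
  obtain ⟨D₂, hD₂, hd₂⟩ := dom6 ζ ρ₂ hT C₂ hC₂ hb₂
  have hζ2 : ∀ x, tail (ζ.conv ρ₂) x ≤ D₂ * tail (ζ.conv ζ) x := by
    intro x
    rw [tail_conv_left6, tail_conv_left6, ← integral_const_mul]
    exact integral_mono (tail_int6 _ _ (by fun_prop))
      ((tail_int6 _ _ (by fun_prop)).const_mul _) fun u => hd₂ _
  have h12 : ∀ x, tail (ρ₁.conv ρ₂) x ≤ D₁ * tail (ζ.conv ρ₂) x := by
    intro x
    rw [tail_conv_right6, tail_conv_right6, ← integral_const_mul]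
    exact integral_mono (tail_int6 _ _ (by fun_prop))
      ((tail_int6 _ _ (by fun_prop)).const_mul _) fun u => hd₁ _
  have h₁' := (littleo6 hT).1 (h₁ a ha)
  have h₂' := (littleo6 hT).1 (h₂ a ha)
  rw [littleo6 hT]
  intro δ hδ
  set e := Real.exp (-γ * a)
  obtain ⟨A₀, hA₀⟩ := eventually_atTop.1 (h₁' (δ / (3 * D₂ * K)) (by positivity))
  obtain ⟨N, hN⟩ := exists_nat_gt (3 * D₁ * D₂ * K / δ)
  have hNpos : (0 : ℝ) < N := lt_of_le_of_lt (by positivity) hN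
  have hG : ∀ A : ℝ, ∀ᶠ x in atTop,
      |e * G6 ρ₁ ρ₂ (x - a) A - G6 ρ₁ ρ₂ x A| ≤ δ / 3 * tail ζ x := by
    intro A
    have hA := hT A
    have hε : 0 < δ * tail ζ A / (3 * K) := by positivity
    obtain ⟨z₀, hz₀⟩ := eventually_atTop.1 (h₂' _ hε)
    filter_upwards [hKb, eventually_ge_atTop (z₀ + A)] with x hx hxz
    refine (G6_diff ρ₁ ρ₂ ζ e a A _ x hε.le fun z hz => hz₀ z (by linarith)).trans ?_
    have h3 := (shift6 ζ x A).trans hx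
    calc δ * tail ζ A / (3 * K) * tail ζ (x - A)
        = δ / (3 * K) * (tail ζ A * tail ζ (x - A)) := by ring
      _ ≤ δ / (3 * K) * (K * tail ζ x) := by gcongr
      _ = δ / 3 * tail ζ x := by field_simp
  have hGall : ∀ᶠ x in atTop, ∀ k ∈ Finset.range N,
      |e * G6 ρ₁ ρ₂ (x - a) (A₀ + k * a) - G6 ρ₁ ρ₂ x (A₀ + k * a)| ≤ δ / 3 * tail ζ x :=
    (Filter.eventually_all_finset _).2 fun k _ => hG _
  filter_upwards [hKb, hGall] with x hx hGx
  have hTx := hT x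
  have hζ2x : tail (ζ.conv ρ₂) x ≤ D₂ * (K * tail ζ x) :=
    (hζ2 x).trans (by gcongr)
  set D := e * tail (ρ₁.conv ρ₂) (x - a) - tail (ρ₁.conv ρ₂) x with hD
  have hF : ∀ k ∈ Finset.range N,
      |D - (F6 ρ₁ ρ₂ x (A₀ + (k + 1 : ℕ) * a) - F6 ρ₁ ρ₂ x (A₀ + k * a))|
        ≤ 2 * δ / 3 * tail ζ x := by
    intro k hk
    have hka : 0 ≤ (k : ℝ) * a := by positivity
    have f1 := F6_diff ρ₁ ρ₂ ζ e a (A₀ + k * a) (δ / (3 * D₂ * K)) x ha (by positivity)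
      fun z hz => hA₀ z (by linarith)
    have f2 : δ / (3 * D₂ * K) * tail (ζ.conv ρ₂) x ≤ δ / 3 * tail ζ x := by
      calc _ ≤ δ / (3 * D₂ * K) * (D₂ * (K * tail ζ x)) := by gcongr
        _ = _ := by field_simp
    have f3 := hGx k hk
    have e1 : A₀ + ((k + 1 : ℕ) : ℝ) * a = A₀ + k * a + a := by push_cast; ring
    rw [e1, hD, split6 ρ₁ ρ₂ (x - a) (A₀ + k * a), split6 ρ₁ ρ₂ x (A₀ + k * a)]
    rw [abs_le] at *
    constructor <;> linarith [f1.1, f1.2, f3.1, f3.2]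
  have hsum := (Finset.abs_sum_le_sum_abs _ _).trans (Finset.sum_le_sum hF)
  rw [Finset.sum_sub_distrib,
    Finset.sum_range_sub (fun k : ℕ => F6 ρ₁ ρ₂ x (A₀ + k * a))] at hsum
  simp only [Finset.sum_const, Finset.card_range, nsmul_eq_mul] at hsum
  have b1 : ∀ A, F6 ρ₁ ρ₂ x A ≤ D₁ * (D₂ * (K * tail ζ x)) := fun A => by
    have := split6 ρ₁ ρ₂ x A
    have := G6_nonneg ρ₁ ρ₂ x A
    have : tail (ρ₁.conv ρ₂) x ≤ D₁ * (D₂ * (K * tail ζ x)) := (h12 x).trans (by gcongr)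
    linarith
  have b2 : D₁ * (D₂ * (K * tail ζ x)) ≤ N * (δ / 3 * tail ζ x) := by
    rw [div_lt_iff₀ hδ] at hN
    have := mul_le_mul_of_nonneg_right hN.le hTx.le
    linarith
  have c1 := b1 (A₀ + N * a)
  have c2 := b1 (A₀ + (0 : ℕ) * a)
  have c3 := F6_nonneg ρ₁ ρ₂ x (A₀ + N * a)
  have c4 := F6_nonneg ρ₁ ρ₂ x (A₀ + (0 : ℕ) * a)
  clear_value D
  generalize F6 ρ₁ ρ₂ x (A₀ + N * a) = p at *
  generalize F6 ρ₁ ρ₂ x (A₀ + (0 : ℕ) * a) = q at *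
  generalize tail ζ x = t at *
  rw [abs_le] at hsum ⊢
  constructor
  · refine le_of_mul_le_mul_left ?_ hNpos
    linarith [hsum.1]
  · refine le_of_mul_le_mul_left ?_ hNpos
    linarith [hsum.2]
end

section
/- Assume the compound Poisson setup. Let γ ≥ 0. If 0 is a limit point of T(γ), i.e., there exists a strictly decreasing sequence (t_n) with t_n → 0 and μ_{t_n} ∈ L(γ) for every n, then for every a ≥ 0, lim_{x→∞} (e^{−γa}·tail(ν₁)(x−a) − tail(ν₁)(x)) / tail(ν₁^{n₀*})(x) = 0. -/
open MeasureTheory Filter Set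

/-- The compound Poisson distribution `μ_t = e^{-t} ∑_k (t^k/k!) ν₁^{k*}`. -/
noncomputable def cpois (nu1 : MeasureTheory.Measure ℝ) (t : ℝ) : MeasureTheory.Measure ℝ :=
  MeasureTheory.Measure.sum (fun k : ℕ =>
    (ENNReal.ofReal (Real.exp (-t) * t ^ k / (Nat.factorial k))) • convPow nu1 k)

/-- `T(γ) = {t > 0 : μ_t ∈ L(γ)}`. -/
def Tset (nu1 : MeasureTheory.Measure ℝ) (γ : ℝ) : Set ℝ :=
  {t : ℝ | 0 < t ∧ MemL γ (cpois nu1 t)}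


lemma convPow_prob_s12 (nu1 : MeasureTheory.Measure ℝ) [MeasureTheory.IsProbabilityMeasure nu1] (k : ℕ) :
    MeasureTheory.IsProbabilityMeasure (convPow nu1 k) := by
  induction k with
  | zero => unfold convPow; infer_instance
  | succ k ih => unfold convPow; infer_instance

lemma tail_cpois_hasSum (nu1 : MeasureTheory.Measure ℝ) [MeasureTheory.IsProbabilityMeasure nu1]
    (u : ℝ) (hu : 0 < u) (x : ℝ) :
    HasSum (fun k : ℕ => u ^ k / (Nat.factorial k) * tail (convPow nu1 k) x)
      (Real.exp u * tail (cpois nu1 u) x) := by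
  have hterm : ∀ k : ℕ, 0 ≤ Real.exp (-u) * u ^ k / (Nat.factorial k) := fun k => by positivity
  have hle1 : ∀ k : ℕ, tail (convPow nu1 k) x ≤ 1 := fun k => by
    have := convPow_prob_s12 nu1 k
    exact ENNReal.toReal_le_of_le_ofReal zero_le_one (by simpa using prob_le_one)
  have hnn : ∀ k : ℕ, 0 ≤ tail (convPow nu1 k) x := fun k => ENNReal.toReal_nonneg
  have hs : Summable (fun k : ℕ => u ^ k / (Nat.factorial k) * tail (convPow nu1 k) x) := by
    refine Summable.of_nonneg_of_le (fun k => mul_nonneg (by positivity) (hnn k)) (fun k => ?_)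
      (Real.summable_pow_div_factorial u)
    exact mul_le_of_le_one_right (by positivity) (hle1 k)
  have heq : tail (cpois nu1 u) x
      = ∑' k : ℕ, Real.exp (-u) * u ^ k / (Nat.factorial k) * tail (convPow nu1 k) x := by
    unfold tail cpois
    rw [Measure.sum_apply _ measurableSet_Ioi, ENNReal.tsum_toReal_eq]
    · refine tsum_congr fun k => ?_
      rw [Measure.smul_apply, smul_eq_mul, ENNReal.toReal_mul, ENNReal.toReal_ofReal (hterm k)]
    · intro k
      have := convPow_prob_s12 nu1 k
      rw [Measure.smul_apply, smul_eq_mul]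
      exact ENNReal.mul_ne_top ENNReal.ofReal_ne_top (measure_ne_top _ _)
  have : Real.exp u * tail (cpois nu1 u) x
      = ∑' k : ℕ, u ^ k / (Nat.factorial k) * tail (convPow nu1 k) x := by
    rw [heq, ← tsum_mul_left]
    refine tsum_congr fun k => ?_
    have : Real.exp u * Real.exp (-u) = 1 := by rw [← Real.exp_add]; simp
    calc _ = (Real.exp u * Real.exp (-u)) * (u ^ k / (Nat.factorial k) * tail (convPow nu1 k) x) := by
            ring
      _ = _ := by rw [this, one_mul]
  rw [this]
  exact hs.hasSum

lemma key_bound (γ : ℝ) (hγ : 0 ≤ γ) (nu1 : MeasureTheory.Measure ℝ)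
    [MeasureTheory.IsProbabilityMeasure nu1] (u s : ℝ) (hu : 0 < u) (hus : u ≤ s)
    (a x : ℝ) (ha : 0 ≤ a) (hx : a ≤ x) :
    |Real.exp u * (Real.exp (-γ * a) * tail (cpois nu1 u) (x - a) - tail (cpois nu1 u) x)
      - u * (Real.exp (-γ * a) * tail nu1 (x - a) - tail nu1 x)|
      ≤ (u / s) ^ 2 * (Real.exp s * (tail (cpois nu1 s) (x - a) + tail (cpois nu1 s) x)) := by
  have hs : 0 < s := hu.trans_le hus
  have hc1 : Real.exp (-γ * a) ≤ 1 := by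
    rw [Real.exp_le_one_iff]; nlinarith
  have hc0 := Real.exp_pos (-γ * a)
  have h1 : convPow nu1 1 = nu1 := by simp [convPow]
  set c := Real.exp (-γ * a)
  have A := ((tail_cpois_hasSum nu1 u hu (x - a)).mul_left c).sub (tail_cpois_hasSum nu1 u hu x)
  have B := A.sub (hasSum_ite_eq (1 : ℕ) (u * (c * tail nu1 (x - a) - tail nu1 x)))
  have G := ((tail_cpois_hasSum nu1 s hs (x - a)).add (tail_cpois_hasSum nu1 s hs x)).mul_left
    ((u / s) ^ 2)
  have hnn : ∀ (k : ℕ) (y : ℝ), 0 ≤ tail (convPow nu1 k) y := fun k y => ENNReal.toReal_nonneg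
  have := HasSum.norm_le_of_bounded B G (fun k => ?_)
  · rw [Real.norm_eq_abs] at this
    convert this using 2 <;> ring
  · rw [Real.norm_eq_abs]
    rcases k with _ | _ | k
    · have z : ∀ y : ℝ, 0 ≤ y → tail (convPow nu1 0) y = 0 := by
        intro y hy
        simp [tail, convPow, hy]
      rw [z x (by linarith), z (x - a) (by linarith)]
      simp
    · have e : c * (u ^ (0 + 1) / ((Nat.factorial (0 + 1) : ℕ) : ℝ) * tail (convPow nu1 (0 + 1)) (x - a))
          - u ^ (0 + 1) / ((Nat.factorial (0 + 1) : ℕ) : ℝ) * tail (convPow nu1 (0 + 1)) x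
          - (if 0 + 1 = 1 then u * (c * tail nu1 (x - a) - tail nu1 x) else 0) = 0 := by
        simp [h1]; ring
      rw [e, abs_zero]
      have := hnn (0 + 1) (x - a)
      have := hnn (0 + 1) x
      positivity
    · rw [if_neg (by omega), sub_zero]
      have p1 := hnn (k + 1 + 1) (x - a)
      have p2 := hnn (k + 1 + 1) x
      have hw : u ^ (k + 1 + 1) / ((Nat.factorial (k + 1 + 1) : ℕ) : ℝ)
          ≤ (u / s) ^ 2 * (s ^ (k + 1 + 1) / ((Nat.factorial (k + 1 + 1) : ℕ) : ℝ)) := by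
        have : (u / s) ^ 2 * (s ^ (k + 1 + 1) / ((Nat.factorial (k + 1 + 1) : ℕ) : ℝ))
            = u ^ 2 * s ^ k / ((Nat.factorial (k + 1 + 1) : ℕ) : ℝ) := by
          field_simp
          ring
        rw [this]
        have : u ^ k ≤ s ^ k := pow_le_pow_left₀ hu.le hus k
        have h2 : u ^ (k + 1 + 1) = u ^ 2 * u ^ k := by ring
        rw [h2]
        gcongr
      have hw0 : 0 ≤ u ^ (k + 1 + 1) / ((Nat.factorial (k + 1 + 1) : ℕ) : ℝ) := by positivity
      generalize u ^ (k + 1 + 1) / ((Nat.factorial (k + 1 + 1) : ℕ) : ℝ) = w at *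
      generalize s ^ (k + 1 + 1) / ((Nat.factorial (k + 1 + 1) : ℕ) : ℝ) = v at *
      generalize tail (convPow nu1 (k + 1 + 1)) (x - a) = P at *
      generalize tail (convPow nu1 (k + 1 + 1)) x = Q at *
      have q1 : w * P ≤ (u / s) ^ 2 * v * P := mul_le_mul_of_nonneg_right hw p1
      have q2 : w * Q ≤ (u / s) ^ 2 * v * Q := mul_le_mul_of_nonneg_right hw p2
      have q3 : 0 ≤ w * P := mul_nonneg hw0 p1
      have q4 : 0 ≤ w * Q := mul_nonneg hw0 p2
      have q5 : c * (w * P) ≤ w * P := mul_le_of_le_one_left q3 hc1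
      have q6 : 0 ≤ c * (w * P) := mul_nonneg hc0.le q3
      have q7 : (u / s) ^ 2 * (v * P + v * Q) = (u / s) ^ 2 * v * P + (u / s) ^ 2 * v * Q := by ring
      rw [q7, abs_le]
      constructor <;> linarith

lemma asymp_upper (ξ ζ : MeasureTheory.Measure ℝ) [IsFiniteMeasure ζ]
    (hpos : ∀ x : ℝ, 0 < x → 0 < ζ (Set.Ioi x)) (h : TailAsymp ξ ζ) :
    ∃ C : ℝ, 0 < C ∧ ∀ᶠ x in atTop, tail ξ x ≤ C * tail ζ x := by
  obtain ⟨c, hc1, hc2⟩ := exists_between h.2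
  refine ⟨c.toReal, ENNReal.toReal_pos (pos_of_gt hc1).ne' hc2.ne, ?_⟩
  filter_upwards [eventually_lt_of_limsup_lt hc1, eventually_gt_atTop 0] with x hx hx0
  have h1 : ξ (Ioi x) ≤ c * ζ (Ioi x) := by
    rw [← ENNReal.div_le_iff (hpos x hx0).ne' (measure_ne_top _ _)]
    exact hx.le
  unfold tail
  rw [← ENNReal.toReal_mul]
  exact ENNReal.toReal_mono (ENNReal.mul_ne_top hc2.ne (measure_ne_top _ _)) h1

lemma cpois_small (γ : ℝ) (nu1 : MeasureTheory.Measure ℝ)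
    (u : ℝ) (h : MemL γ (cpois nu1 u)) (a : ℝ) (ε : ℝ) (hε : 0 < ε) :
    ∀ᶠ x in atTop, |Real.exp (-γ * a) * tail (cpois nu1 u) (x - a) - tail (cpois nu1 u) x|
      ≤ ε * tail (cpois nu1 u) x := by
  have := h.2 (-a)
  rw [Metric.tendsto_nhds] at this
  filter_upwards [this (min ε 1) (lt_min hε one_pos)] with x hx
  rw [Real.dist_eq, ← sub_eq_add_neg] at hx
  rcases (show 0 ≤ tail (cpois nu1 u) x from ENNReal.toReal_nonneg).eq_or_lt' with h0 | h0
  · exfalso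
    rw [h0, mul_zero, div_zero] at hx
    have := lt_of_lt_of_le hx (min_le_right _ _)
    norm_num at this
  · have e : Real.exp (-γ * a) * tail (cpois nu1 u) (x - a) - tail (cpois nu1 u) x
        = (tail (cpois nu1 u) (x - a) / (Real.exp (-γ * -a) * tail (cpois nu1 u) x) - 1)
          * tail (cpois nu1 u) x := by
      rw [show -γ * -a = -(-γ * a) by ring, Real.exp_neg]
      have := Real.exp_pos (-γ * a)
      field_simp
    rw [e, abs_mul, abs_of_pos h0]
    exact mul_le_mul_of_nonneg_right (hx.le.trans (min_le_left _ _)) h0.le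

theorem stmt12 (γ : ℝ) (hγ : 0 ≤ γ) (nu1 : MeasureTheory.Measure ℝ) [MeasureTheory.IsProbabilityMeasure nu1]
    (hsupp : nu1 (Set.Ioi 1) = 1)
    (n₀ : ℕ) (hn₀pos : 0 < n₀) (hn₀OS : MemOS (convPow nu1 n₀))
    (hn₀min : ∀ m : ℕ, 0 < m → MemOS (convPow nu1 m) → n₀ ≤ m)
    (hasymp : ∀ t : ℝ, 0 < t → TailAsymp (cpois nu1 t) (convPow nu1 n₀))
    (t : ℕ → ℝ) (ht : StrictAnti t) (ht0 : Filter.Tendsto t Filter.atTop (nhds 0))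
    (htT : ∀ n : ℕ, t n ∈ Tset nu1 γ) :
    ∀ a : ℝ, 0 ≤ a → Filter.Tendsto
      (fun x : ℝ => (Real.exp (-γ * a) * tail nu1 (x - a) - tail nu1 x)
        / tail (convPow nu1 n₀) x) Filter.atTop (nhds 0) := by
  intro a ha
  have := convPow_prob_s12 nu1 n₀
  have hpos := hn₀OS.1
  have hH : ∀ x : ℝ, 0 < x → 0 < tail (convPow nu1 n₀) x := fun x hx =>
    ENNReal.toReal_pos (hpos x hx).ne' (measure_ne_top _ _)
  set H := tail (convPow nu1 n₀) with hHdef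
  set s := t 0 with hsdef
  have hs : 0 < s := (htT 0).1
  obtain ⟨C, hC, hCe⟩ := asymp_upper _ _ hpos (hasymp s hs)
  have hsm := cpois_small γ nu1 s (htT 0).2 a 1 one_pos
  set c := Real.exp (-γ * a) with hcdef
  have hc : 0 < c := Real.exp_pos _
  set K := Real.exp s * (2 / c + 1) * C / s ^ 2 with hK
  have hKpos : 0 < K := by positivity
  rw [Metric.tendsto_nhds]
  intro ε hε
  obtain ⟨n, hn⟩ := (ht0.eventually (gt_mem_nhds (show 0 < ε / (2 * K) by positivity))).exists
  set u := t n with hudef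
  have hu : 0 < u := (htT n).1
  have hus : u ≤ s := ht.antitone (Nat.zero_le n)
  obtain ⟨D, hD, hDe⟩ := asymp_upper _ _ hpos (hasymp u hu)
  have hsu := cpois_small γ nu1 u (htT n).2 a (ε * u / (4 * D * Real.exp u)) (by positivity)
  filter_upwards [hCe, hsm, hDe, hsu, eventually_gt_atTop 0, eventually_ge_atTop a] with
    x h1 h2 h3 h4 hx0 hxa
  have hk := key_bound γ hγ nu1 u s hu hus a x ha hxa
  have hHx := hH x hx0
  rw [Real.dist_eq, sub_zero, abs_div, abs_of_pos hHx, div_lt_iff₀ hHx]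
  rw [← hcdef] at hk h4
  rw [← hHdef] at h1 h3
  set Δ := c * tail nu1 (x - a) - tail nu1 x
  set E := c * tail (cpois nu1 u) (x - a) - tail (cpois nu1 u) x
  have b1 : tail (cpois nu1 s) (x - a) ≤ 2 / c * tail (cpois nu1 s) x := by
    have := (abs_le.1 h2).2
    rw [div_mul_eq_mul_div, le_div_iff₀ hc]
    linarith
  have b2 : (u / s) ^ 2 * (Real.exp s * (tail (cpois nu1 s) (x - a) + tail (cpois nu1 s) x))
      ≤ u ^ 2 * K * H x := by
    calc _ ≤ (u / s) ^ 2 * (Real.exp s * ((2 / c + 1) * (C * H x))) := by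
          gcongr
          calc _ ≤ (2 / c + 1) * tail (cpois nu1 s) x := by linarith
            _ ≤ _ := by gcongr
      _ = _ := by rw [hK]; field_simp
  have b3 : Real.exp u * |E| ≤ u * (ε / 4) * H x := by
    calc _ ≤ Real.exp u * (ε * u / (4 * D * Real.exp u) * (D * H x)) := by
          gcongr
          exact h4.trans (by gcongr)
      _ = _ := by field_simp
  have b4 : u * |Δ| ≤ u * (ε / 4) * H x + u ^ 2 * K * H x := by
    have t1 : |u * Δ| ≤ |Real.exp u * E| + |Real.exp u * E - u * Δ| := by
      have := abs_sub (Real.exp u * E) (Real.exp u * E - u * Δ)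
      simpa using this
    rw [abs_mul, abs_mul, abs_of_pos hu, abs_of_pos (Real.exp_pos u)] at t1
    linarith
  have b5 : u * K < ε / 2 := by
    rw [lt_div_iff₀ (by positivity)] at hn
    linarith
  have b6 : |Δ| ≤ (ε / 4) * H x + u * K * H x := by
    refine le_of_mul_le_mul_left ?_ hu
    calc _ ≤ _ := b4
      _ = _ := by ring
  nlinarith [mul_lt_mul_of_pos_right b5 hHx, mul_pos hε hHx]
end
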